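/- Let J₀, J₁ be the Bessel functions of the first kind of orders 0 and 1 (defined by Jₙ(x) = (1/π)∫₀^π cos(nθ − x sin θ) dθ), let H₀, H₁ be the Struve functions of orders 0 and 1, and let D(x) = H₀(x)·J₁(x) − H₁(x)·J₀(x). Then for all reals c₀, c₁, all 0 ≤ α ≤ β, and all p > 0, the order-zero Hankel integral of the linear function c₀ + c₁ r over [α, β] has the closed form: ∫_α^β (c₀ + c₁ r)·J₀(p r)·r dr = (c₀/p²)·(β p·J₁(β p) − α p·J₁(α p)) + (c₁/p³)·((β p)²·J₁(β p) − (α p)²·J₁(α p) − (π/2)·(β p·D(β p) − α p·D(α p))). -/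

import Mathlib

open Real MeasureTheory

noncomputable def J0 (x : ℝ) : ℝ := (1 / π) * ∫ θ in (0:ℝ)..π, Real.cos (x * Real.sin θ)

noncomputable def J1 (x : ℝ) : ℝ := (1 / π) * ∫ θ in (0:ℝ)..π, Real.cos (θ - x * Real.sin θ)

noncomputable def H0 (x : ℝ) : ℝ :=
  (2 / π) * ∫ θ in (0:ℝ)..(π / 2), Real.sin (x * Real.cos θ)

noncomputable def H1 (x : ℝ) : ℝ :=
  (2 * x / π) * ∫ θ in (0:ℝ)..(π / 2), Real.sin (x * Real.cos θ) * Real.sin θ ^ 2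

noncomputable def D (x : ℝ) : ℝ := H0 x * J1 x - H1 x * J0 x

theorem hasDerivAt_integral_mul_comp {a b : ℝ} {g f φ φ' : ℝ → ℝ} (hg : Continuous g)
    (hf : Continuous f) (hφ' : Continuous φ') (hd : ∀ y, HasDerivAt φ (φ' y) y)
    (hb : ∀ y, |φ' y| ≤ 1) (x : ℝ) :
    HasDerivAt (fun x => ∫ θ in a..b, g θ * φ (x * f θ))
      (∫ θ in a..b, g θ * (φ' (x * f θ) * f θ)) x := by
  have hφ : Continuous φ := continuous_iff_continuousAt.2 fun y => (hd y).continuousAt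
  refine (intervalIntegral.hasDerivAt_integral_of_dominated_loc_of_deriv_le
    (F := fun x θ => g θ * φ (x * f θ)) (F' := fun x θ => g θ * (φ' (x * f θ) * f θ))
    (bound := fun θ => |g θ| * |f θ|) (s := Set.univ) Filter.univ_mem ?_ ?_ ?_ ?_ ?_ ?_).2
  · exact Filter.Eventually.of_forall fun y =>
      (by fun_prop : Continuous fun θ => g θ * φ (y * f θ)).aestronglyMeasurable
  · exact (by fun_prop : Continuous fun θ => g θ * φ (x * f θ)).intervalIntegrable _ _
  · exact (by fun_prop :
      Continuous fun θ => g θ * (φ' (x * f θ) * f θ)).aestronglyMeasurable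
  · refine Filter.Eventually.of_forall fun θ _ y _ => ?_
    rw [Real.norm_eq_abs, abs_mul, abs_mul]
    have := mul_le_mul_of_nonneg_right (hb (y * f θ)) (abs_nonneg (f θ))
    rw [one_mul] at this
    exact mul_le_mul_of_nonneg_left this (abs_nonneg _)
  · exact (by fun_prop : Continuous fun θ => |g θ| * |f θ|).intervalIntegrable _ _
  · refine Filter.Eventually.of_forall fun θ _ y _ => ?_
    have h := (hd (y * f θ)).comp y ((hasDerivAt_id y).mul_const (f θ))
    rw [one_mul] at h
    exact h.const_mul (g θ)

theorem hasDerivAt_integral_mul_cos {a b : ℝ} {g f : ℝ → ℝ} (hg : Continuous g)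
    (hf : Continuous f) (x : ℝ) :
    HasDerivAt (fun x => ∫ θ in a..b, g θ * Real.cos (x * f θ))
      (∫ θ in a..b, g θ * (-Real.sin (x * f θ) * f θ)) x :=
  hasDerivAt_integral_mul_comp (φ' := fun y => -Real.sin y) hg hf (by fun_prop)
    Real.hasDerivAt_cos (fun y => by rw [abs_neg]; exact Real.abs_sin_le_one y) x

theorem hasDerivAt_integral_mul_sin {a b : ℝ} {g f : ℝ → ℝ} (hg : Continuous g)
    (hf : Continuous f) (x : ℝ) :
    HasDerivAt (fun x => ∫ θ in a..b, g θ * Real.sin (x * f θ))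
      (∫ θ in a..b, g θ * (Real.cos (x * f θ) * f θ)) x :=
  hasDerivAt_integral_mul_comp hg hf Real.continuous_cos
    Real.hasDerivAt_sin Real.abs_cos_le_one x

theorem integral_cos_mul_cos_mul_sin (x : ℝ) :
    ∫ θ in (0:ℝ)..π, Real.cos θ * Real.cos (x * Real.sin θ) = 0 := by
  rcases eq_or_ne x 0 with rfl | hx
  · simp
  · have h : ∀ θ ∈ Set.uIcc 0 π, HasDerivAt (fun θ => Real.sin (x * Real.sin θ) / x)
        (Real.cos θ * Real.cos (x * Real.sin θ)) θ := fun θ _ => by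
      refine ((((Real.hasDerivAt_sin θ).const_mul x).sin).div_const x).congr_deriv ?_
      field_simp
    rw [intervalIntegral.integral_eq_sub_of_hasDerivAt h
      ((by fun_prop : Continuous _).intervalIntegrable _ _)]
    simp

theorem integral_sin_mul_sin_mul_sin (x : ℝ) :
    ∫ θ in (0:ℝ)..π, Real.sin θ * Real.sin (x * Real.sin θ) =
      x * ∫ θ in (0:ℝ)..π, Real.cos θ ^ 2 * Real.cos (x * Real.sin θ) := by
  have h : ∀ θ ∈ Set.uIcc 0 π, HasDerivAt (fun θ => Real.cos θ * Real.sin (x * Real.sin θ))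
      (x * (Real.cos θ ^ 2 * Real.cos (x * Real.sin θ))
        - Real.sin θ * Real.sin (x * Real.sin θ)) θ := fun θ _ => by
    refine ((Real.hasDerivAt_cos θ).mul ((Real.hasDerivAt_sin θ).const_mul x).sin).congr_deriv ?_
    ring
  have key := intervalIntegral.integral_eq_sub_of_hasDerivAt h
    ((by fun_prop : Continuous _).intervalIntegrable _ _)
  rw [intervalIntegral.integral_sub ((by fun_prop : Continuous _).intervalIntegrable _ _)
    ((by fun_prop : Continuous _).intervalIntegrable _ _),
    intervalIntegral.integral_const_mul] at key
  simp only [Real.sin_pi, Real.sin_zero, mul_zero, sub_self] at key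
  linarith

theorem integral_cos_mul_cos_mul_cos (x : ℝ) :
    ∫ θ in (0:ℝ)..(π / 2), Real.cos θ * Real.cos (x * Real.cos θ) =
      1 - x * ∫ θ in (0:ℝ)..(π / 2), Real.sin (x * Real.cos θ) * Real.sin θ ^ 2 := by
  have h : ∀ θ ∈ Set.uIcc 0 (π / 2),
      HasDerivAt (fun θ => Real.sin θ * Real.cos (x * Real.cos θ))
      (Real.cos θ * Real.cos (x * Real.cos θ)
        + x * (Real.sin (x * Real.cos θ) * Real.sin θ ^ 2)) θ := fun θ _ => by
    refine ((Real.hasDerivAt_sin θ).mul ((Real.hasDerivAt_cos θ).const_mul x).cos).congr_deriv ?_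
    ring
  have key := intervalIntegral.integral_eq_sub_of_hasDerivAt h
    ((by fun_prop : Continuous _).intervalIntegrable _ _)
  rw [intervalIntegral.integral_add ((by fun_prop : Continuous _).intervalIntegrable _ _)
    ((by fun_prop : Continuous _).intervalIntegrable _ _),
    intervalIntegral.integral_const_mul] at key
  simp only [Real.sin_pi_div_two, Real.cos_pi_div_two, Real.sin_zero, mul_zero, Real.cos_zero,
    zero_mul, sub_zero, mul_one] at key
  linarith

theorem J1_eq (x : ℝ) :
    J1 x = (1 / π) * ∫ θ in (0:ℝ)..π, Real.sin θ * Real.sin (x * Real.sin θ) := by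
  simp only [J1, Real.cos_sub]
  rw [intervalIntegral.integral_add ((by fun_prop : Continuous _).intervalIntegrable _ _)
    ((by fun_prop : Continuous _).intervalIntegrable _ _), integral_cos_mul_cos_mul_sin, zero_add]

theorem H1_eq (x : ℝ) :
    H1 x = (2 / π) *
      (1 - ∫ θ in (0:ℝ)..(π / 2), Real.cos θ * Real.cos (x * Real.cos θ)) := by
  rw [integral_cos_mul_cos_mul_cos, H1]
  ring

theorem hasDerivAt_J0 (x : ℝ) : HasDerivAt J0 (-J1 x) x := by
  have h := (hasDerivAt_integral_mul_cos (a := 0) (b := π) (g := fun _ => 1)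
    continuous_const Real.continuous_sin x).const_mul (1 / π)
  simp only [one_mul] at h
  refine h.congr_deriv ?_
  rw [J1_eq, ← mul_neg, ← intervalIntegral.integral_neg]
  congr 2
  ext θ
  ring

theorem hasDerivAt_mul_J1 (x : ℝ) : HasDerivAt (fun x => x * J1 x) (x * J0 x) x := by
  have h := (hasDerivAt_integral_mul_sin (a := 0) (b := π) Real.continuous_sin
    Real.continuous_sin x).const_mul (1 / π)
  rw [← funext J1_eq] at h
  refine ((hasDerivAt_id x).mul h).congr_deriv ?_
  have hs : ∫ θ in (0:ℝ)..π, Real.cos (x * Real.sin θ) =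
      (∫ θ in (0:ℝ)..π, Real.cos θ ^ 2 * Real.cos (x * Real.sin θ)) +
      ∫ θ in (0:ℝ)..π, Real.sin θ * (Real.cos (x * Real.sin θ) * Real.sin θ) := by
    rw [← intervalIntegral.integral_add ((by fun_prop : Continuous _).intervalIntegrable _ _)
      ((by fun_prop : Continuous _).intervalIntegrable _ _)]
    congr 1
    ext θ
    linear_combination (-Real.cos (x * Real.sin θ)) * Real.sin_sq_add_cos_sq θ
  rw [J1_eq, integral_sin_mul_sin_mul_sin, J0, hs]
  simp only [id]
  ring

theorem hasDerivAt_H0 (x : ℝ) : HasDerivAt H0 (2 / π - H1 x) x := by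
  have h := (hasDerivAt_integral_mul_sin (a := 0) (b := π / 2) (g := fun _ => 1)
    continuous_const Real.continuous_cos x).const_mul (2 / π)
  simp only [one_mul] at h
  refine h.congr_deriv ?_
  rw [H1_eq]
  simp only [mul_comm (Real.cos (x * _))]
  ring

theorem hasDerivAt_mul_H1 (x : ℝ) : HasDerivAt (fun x => x * H1 x) (x * H0 x) x := by
  have h := ((hasDerivAt_integral_mul_cos (a := 0) (b := π / 2) Real.continuous_cos
    Real.continuous_cos x).const_sub 1).const_mul (2 / π)
  rw [← funext H1_eq] at h
  refine ((hasDerivAt_id x).mul h).congr_deriv ?_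
  have hs : ∫ θ in (0:ℝ)..(π / 2), Real.sin (x * Real.cos θ) =
      (∫ θ in (0:ℝ)..(π / 2), Real.sin (x * Real.cos θ) * Real.sin θ ^ 2) -
      ∫ θ in (0:ℝ)..(π / 2), Real.cos θ * (-Real.sin (x * Real.cos θ) * Real.cos θ) := by
    rw [← intervalIntegral.integral_sub ((by fun_prop : Continuous _).intervalIntegrable _ _)
      ((by fun_prop : Continuous _).intervalIntegrable _ _)]
    congr 1
    ext θ
    linear_combination (-Real.sin (x * Real.cos θ)) * Real.sin_sq_add_cos_sq θ
  rw [H1, H0, hs]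
  simp only [id]
  ring

theorem hasDerivAt_mul_D (x : ℝ) : HasDerivAt (fun x => x * D x) (2 / π * (x * J1 x)) x := by
  have h := ((hasDerivAt_H0 x).mul (hasDerivAt_mul_J1 x)).sub
    ((hasDerivAt_mul_H1 x).mul (hasDerivAt_J0 x))
  refine (h.congr_deriv ?_).congr_of_eventuallyEq (Filter.Eventually.of_forall fun y => ?_)
  · ring
  · simp only [D, Pi.sub_apply, Pi.mul_apply]
    ring

theorem hasDerivAt_sq_mul_J1_sub_mul_D (x : ℝ) :
    HasDerivAt (fun x => x * (x * J1 x) - (π / 2) * (x * D x)) (x ^ 2 * J0 x) x := by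
  refine (((hasDerivAt_id x).mul (hasDerivAt_mul_J1 x)).sub
    ((hasDerivAt_mul_D x).const_mul (π / 2))).congr_deriv ?_
  simp only [id]
  field_simp
  ring

theorem hankel_linear_J0 (c₀ c₁ α β p : ℝ) (hα : 0 ≤ α) (hαβ : α ≤ β) (hp : 0 < p) :
    ∫ r in α..β, (c₀ + c₁ * r) * J0 (p * r) * r =
      (c₀ / p ^ 2) * (β * p * J1 (β * p) - α * p * J1 (α * p)) +
      (c₁ / p ^ 3) * ((β * p) ^ 2 * J1 (β * p) - (α * p) ^ 2 * J1 (α * p) -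
        (π / 2) * (β * p * D (β * p) - α * p * D (α * p))) := by
  have hJ0 : Continuous J0 :=
    continuous_iff_continuousAt.2 fun y => (hasDerivAt_J0 y).continuousAt
  have hderiv : ∀ r ∈ Set.uIcc α β, HasDerivAt
      (fun r => (c₀ / p ^ 2) * (r * p * J1 (r * p)) + (c₁ / p ^ 3) *
        (r * p * (r * p * J1 (r * p)) - (π / 2) * (r * p * D (r * p))))
      ((c₀ + c₁ * r) * J0 (p * r) * r) r := fun r _ => by
    have hlin : HasDerivAt (fun r => r * p) p r := by
      simpa using (hasDerivAt_id r).mul_const p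
    refine ((((hasDerivAt_mul_J1 (r * p)).comp r hlin).const_mul (c₀ / p ^ 2)).add
      (((hasDerivAt_sq_mul_J1_sub_mul_D (r * p)).comp r hlin).const_mul
        (c₁ / p ^ 3))).congr_deriv ?_
    rw [mul_comm p r]
    field_simp
  rw [intervalIntegral.integral_eq_sub_of_hasDerivAt hderiv
    ((by fun_prop : Continuous _).intervalIntegrable _ _)]
  ring
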